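/- arXiv:2407.10007 — 7 statements merged into one kernel-verified Lean document; each statement's English description precedes it below -/
import Mathlib

section
/- Let G be a finite loopless multigraph and let (L,C) be a derangement assignment on G. Suppose there exists a biorientation D of G such that (i) the biorientation that D induces on the straight subgraph G_S is kernel-perfect, (ii) every twisted edge of G belongs to E_{D2}(G), i.e., is oriented in both directions in D, and (iii) |L(v)| ≥ d⁺_D(v) + 1 for every vertex v of G. Then G admits an (L,C)-coloring. -/
/-!
Statement 0 (Theorem, Bondy–Boppana–Siegel for derangement assignments):
A finite loopless multigraph `G` is modeled by a vertex type `V`, an edge-index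
type `E`, and an endpoint map `ends : E → Sym2 V` with no edge diagonal (loopless).

A correspondence assignment `(L, C)` is given by lists `L : V → Finset α` and a
relation `C : E → V → α → V → α → Prop`, where `C e u a v b` means that the pair
`{(u,a),(v,b)}` belongs to the partial matching `C_e`.  The hypotheses below say
that each `C_e` is a symmetric partial matching between `{u} × L u` and
`{v} × L v` where `ends e = s(u,v)`.

An edge `e` is *straight* when `∀ u a v b, C e u a v b → a = b`, and *twisted*
otherwise.  `(L, C)` is a *derangement assignment* when every twisted edge is a
partial derangement (never matches equal colors).

A *biorientation* `D : E → V → V → Prop` assigns to each edge at least one of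
its two directions (`D e u v` is the arc from `u` to `v` along `e`).  The
out-degree of `v` is `Nat.card {e : E // ∃ w, D e v w}` (each edge carries at
most one out-arc at `v`, since `G` is loopless).

The kernel-perfectness hypothesis says that the biorientation induced by `D` on
the straight subgraph `G_S` is kernel-perfect: every induced subdigraph (on any
`A : Set V`) has a kernel `U` (independent in `G_S`, and every vertex of
`A \ U` sends a straight arc into `U`).

Conclusion: there is an `(L, C)`-coloring of `G`.
-/
theorem derangement_assignment_BBS
    {V E α : Type*} [Fintype V] [Fintype E]
    (ends : E → Sym2 V)
    (hloopless : ∀ e, ¬ (ends e).IsDiag)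
    (L : V → Finset α)
    (C : E → V → α → V → α → Prop)
    -- `(L, C)` is a correspondence assignment:
    (hCsymm : ∀ e u a v b, C e u a v b → C e v b u a)
    (hCsupp : ∀ e u a v b, C e u a v b → ends e = s(u, v) ∧ a ∈ L u ∧ b ∈ L v)
    (hCmatch : ∀ e u a v b b', C e u a v b → C e u a v b' → b = b')
    -- `(L, C)` is a derangement assignment: every twisted edge is a partial derangement:
    (hder : ∀ e, ¬ (∀ u a v b, C e u a v b → a = b) →
      ∀ u v c, c ∈ L u → c ∈ L v → ¬ C e u c v c)
    -- `D` is a biorientation of `G`: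
    (D : E → V → V → Prop)
    (hDsupp : ∀ e u v, D e u v → ends e = s(u, v))
    (hDorient : ∀ e u v, ends e = s(u, v) → D e u v ∨ D e v u)
    -- (i) `D` induces a kernel-perfect biorientation of the straight subgraph `G_S`:
    (hkernel : ∀ A : Set V, ∃ U : Set V, U ⊆ A ∧
      (∀ u ∈ U, ∀ u' ∈ U, ∀ e, (∀ x a y b, C e x a y b → a = b) → ends e ≠ s(u, u')) ∧
      (∀ v ∈ A, v ∉ U → ∃ u ∈ U, ∃ e, (∀ x a y b, C e x a y b → a = b) ∧ D e v u))
    -- (ii) every twisted edge is oriented in both directions in `D`: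
    (htwist : ∀ e, ¬ (∀ u a v b, C e u a v b → a = b) →
      ∀ u v, ends e = s(u, v) → D e u v ∧ D e v u)
    -- (iii) `|L v| ≥ d⁺_D v + 1` for every vertex `v`:
    (hsize : ∀ v, (L v).card ≥ Nat.card {e : E // ∃ w, D e v w} + 1) :
    -- Conclusion: `G` admits an `(L, C)`-coloring.
    ∃ φ : V → α, (∀ v, φ v ∈ L v) ∧
      ∀ e u v, ends e = s(u, v) → ¬ C e u (φ u) v (φ v) := by
  classical
  -- Induct on the set `W` of vertices still to be coloured, with residual lists `M`.
  have extend : ∀ (n : ℕ) (W : Finset V) (M : V → Finset α), W.card = n →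
      (∀ v, M v ⊆ L v) →
      (∀ v ∈ W, {e : E | ∃ w ∈ W, D e v w}.ncard + 1 ≤ (M v).card) →
      ∃ φ : V → α, (∀ v ∈ W, φ v ∈ M v) ∧
        ∀ e, ∀ u ∈ W, ∀ v ∈ W, ¬ C e u (φ u) v (φ v) := by
    intro n
    induction n using Nat.strong_induction_on with
    | _ n ih =>
    intro W M hn hML hM
    rcases W.eq_empty_or_nonempty with rfl | ⟨v₀, hv₀⟩
    · have hne : ∀ v, ∃ a, a ∈ L v := fun v =>
        Finset.card_pos.1 (lt_of_lt_of_le (Nat.succ_pos _) (hsize v))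
      choose φ _ using hne
      exact ⟨φ, by simp, by simp⟩
    obtain ⟨c, hc⟩ : (M v₀).Nonempty :=
      Finset.card_pos.1 (lt_of_lt_of_le (Nat.succ_pos _) (hM v₀ hv₀))
    -- Give the colour `c` to a kernel `U` of the straight graph on the vertices that admit `c`.
    obtain ⟨U, hUA, hUind, hUdom⟩ := hkernel {v | v ∈ W ∧ c ∈ M v}
    obtain ⟨u₀, hu₀⟩ : U.Nonempty := by
      by_cases h : v₀ ∈ U
      · exact ⟨v₀, h⟩
      · obtain ⟨u, hu, -⟩ := hUdom v₀ ⟨hv₀, hc⟩ h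
        exact ⟨u, hu⟩
    let W' := W.filter (· ∉ U)
    let M' : V → Finset α := fun v =>
      (M v).filter fun b => b ≠ c ∧ ∀ e, ∀ u ∈ U, ¬ C e u c v b
    have hlt : W'.card < n := by
      rw [← hn]
      refine Finset.card_lt_card (Finset.filter_ssubset.2 ⟨u₀, (hUA hu₀).1, ?_⟩)
      simpa using hu₀
    have hM' : ∀ v ∈ W', {e : E | ∃ w ∈ W', D e v w}.ncard + 1 ≤ (M' v).card := by
      intro v hv
      obtain ⟨hvW, hvU⟩ := Finset.mem_filter.1 hv
      -- Every colour deleted at `v` is charged to an arc from `v` into `U`.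
      have hcharge : ∀ b ∈ M v \ M' v, ∃ e : E,
          (∃ w ∈ U, D e v w) ∧
          ((b = c ∧ ∀ x a y b, C e x a y b → a = b) ∨
            (b ≠ c ∧ ∃ u ∈ U, C e u c v b)) := by
        intro b hb
        obtain ⟨hbM, hbM'⟩ := Finset.mem_sdiff.1 hb
        by_cases hbc : b = c
        · subst hbc
          obtain ⟨u, hu, e, he, hD⟩ := hUdom v ⟨hvW, hbM⟩ hvU
          exact ⟨e, ⟨u, hu, hD⟩, Or.inl ⟨rfl, he⟩⟩
        · obtain ⟨e, u, hu, hC⟩ : ∃ e, ∃ u ∈ U, C e u c v b := by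
            by_contra! h
            exact hbM' (Finset.mem_filter.2 ⟨hbM, hbc, h⟩)
          refine ⟨e, ⟨u, hu, ?_⟩, Or.inr ⟨hbc, u, hu, hC⟩⟩
          exact (htwist e (fun h => hbc (h _ _ _ _ hC).symm) u v (hCsupp _ _ _ _ _ hC).1).2
      choose f hf using hcharge
      have hdel : (M v \ M' v).card ≤ {e : E | ∃ w ∈ U, D e v w}.ncard := by
        rw [← Nat.card_coe_set_eq, ← Fintype.card_coe, ← Nat.card_eq_fintype_card]
        refine Nat.card_le_card_of_injective
          (fun b : ↥(M v \ M' v) => ⟨f b b.2, (hf b b.2).1⟩) ?_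
        rintro ⟨b, hb⟩ ⟨b', hb'⟩ hbb
        replace hbb : f b hb = f b' hb' := congrArg Subtype.val hbb
        refine Subtype.ext (show b = b' from ?_)
        rcases (hf b hb).2 with ⟨h1, h2⟩ | ⟨h1, u, hu, h2⟩ <;>
          rcases (hf b' hb').2 with ⟨h1', h2'⟩ | ⟨h1', u', hu', h2'⟩
        · rw [h1, h1']
        · rw [hbb] at h2
          exact absurd (h2 _ _ _ _ h2').symm h1'
        · rw [← hbb] at h2'
          exact absurd (h2' _ _ _ _ h2).symm h1
        · rw [← hbb] at h2'
          obtain rfl : u = u' := Sym2.congr_left.1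
            ((hCsupp _ _ _ _ _ h2).1.symm.trans (hCsupp _ _ _ _ _ h2').1)
          exact hCmatch _ _ _ _ _ _ h2 h2'
      have hdisj : Disjoint {e : E | ∃ w ∈ U, D e v w} {e : E | ∃ w ∈ W', D e v w} := by
        rw [Set.disjoint_left]
        rintro e ⟨w, hw, hD⟩ ⟨w', hw', hD'⟩
        obtain rfl : w = w' := Sym2.congr_right.1
          ((hDsupp _ _ _ hD).symm.trans (hDsupp _ _ _ hD'))
        exact (Finset.mem_filter.1 hw').2 hw
      have hsplit : {e : E | ∃ w ∈ U, D e v w}.ncard + {e : E | ∃ w ∈ W', D e v w}.ncard ≤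
          {e : E | ∃ w ∈ W, D e v w}.ncard := by
        rw [← Set.ncard_union_eq hdisj (Set.toFinite _) (Set.toFinite _)]
        refine Set.ncard_le_ncard ?_ (Set.toFinite _)
        rintro e (⟨w, hw, hD⟩ | ⟨w, hw, hD⟩)
        · exact ⟨w, (hUA hw).1, hD⟩
        · exact ⟨w, (Finset.mem_filter.1 hw).1, hD⟩
      have hcard : (M v \ M' v).card + (M' v).card = (M v).card :=
        Finset.card_sdiff_add_card_eq_card (Finset.filter_subset _ _)
      have := hM v hvW
      omega
    obtain ⟨φ, hφM, hφC⟩ := ih _ hlt W' M' rfl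
      (fun v => (Finset.filter_subset _ _).trans (hML v)) hM'
    have hφ : ∀ v ∈ W, v ∉ U → φ v ∈ M v ∧ φ v ≠ c ∧ ∀ e, ∀ u ∈ U, ¬ C e u c v (φ v) :=
      fun v hv hvU => Finset.mem_filter.1 (hφM v (Finset.mem_filter.2 ⟨hv, hvU⟩))
    refine ⟨fun v => if v ∈ U then c else φ v, fun v hv => ?_, fun e u hu v hv hC => ?_⟩
    · by_cases hvU : v ∈ U
      · simpa [hvU] using (hUA hvU).2
      · simpa [hvU] using (hφ v hv hvU).1
    · by_cases huU : u ∈ U <;> by_cases hvU : v ∈ U <;>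
        simp only [huU, hvU, if_true, if_false] at hC
      · by_cases he : ∀ x a y b, C e x a y b → a = b
        · exact hUind u huU v hvU e he (hCsupp _ _ _ _ _ hC).1
        · exact hder e he u v c (hML u (hUA huU).2) (hML v (hUA hvU).2) hC
      · exact (hφ v hv hvU).2.2 e u huU hC
      · exact (hφ u hu huU).2.2 e v hvU (hCsymm _ _ _ _ _ hC)
      · exact hφC e u (Finset.mem_filter.2 ⟨hu, huU⟩) v (Finset.mem_filter.2 ⟨hv, hvU⟩) hC
  obtain ⟨φ, hφL, hφC⟩ := extend _ Finset.univ L rfl (fun _ => Finset.Subset.refl _) (by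
    intro v _
    simp only [Finset.mem_univ, true_and, ← Nat.card_coe_set_eq]
    exact hsize v)
  exact ⟨φ, fun v => hφL v (Finset.mem_univ v),
    fun e u v _ => hφC e u (Finset.mem_univ u) v (Finset.mem_univ v)⟩
end

section
/- Let G be a finite loopless multigraph and let (L,C) be a derangement assignment on G. Suppose there exists a biorientation D of G such that (i) every twisted edge of G belongs to E_{D2}(G), i.e., is oriented in both directions in D, (ii) every odd directed cycle of D contains a twisted edge, and (iii) |L(v)| ≥ d⁺_D(v) + 1 for every vertex v of G. Then G admits an (L,C)-coloring. -/
/-!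
Statement 1 (Corollary, via Richardson's theorem):
A finite loopless multigraph `G` is modeled by a vertex type `V`, an edge-index
type `E`, and an endpoint map `ends : E → Sym2 V` with no edge diagonal.

`(L, C)` is a derangement assignment on `G` (see the hypotheses), and
`D : E → V → V → Prop` is a biorientation of `G` such that every twisted edge is
oriented in both directions, every odd directed cycle of `D` contains a twisted
edge, and `|L v| ≥ d⁺_D v + 1` for every vertex `v`.  A directed cycle of length
`n` is encoded as an injective map `c : ZMod n → V` together with edges
`ce : ZMod n → E` such that `ce i` carries the arc from `c i` to `c (i + 1)`.

Conclusion: `G` admits an `(L, C)`-coloring.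
-/
/-- `HasWalk A n u v` says that the relation `A` admits a walk of length `n` from `u` to `v`. -/
def HasWalk {V : Type*} (A : V → V → Prop) (n : ℕ) (u v : V) : Prop :=
  ∃ f : ℕ → V, f 0 = u ∧ f n = v ∧ ∀ i < n, A (f i) (f (i + 1))

namespace HasWalk

variable {V : Type*} {A B : V → V → Prop} {m n : ℕ} {u v w : V}

theorem refl (A : V → V → Prop) (u : V) : HasWalk A 0 u u :=
  ⟨fun _ => u, rfl, rfl, by simp⟩

theorem single (h : A u v) : HasWalk A 1 u v :=
  ⟨fun i => if i = 0 then u else v, by simp, by simp, by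
    intro i hi
    obtain rfl : i = 0 := by omega
    simpa using h⟩

theorem mono (hAB : ∀ x y, A x y → B x y) (h : HasWalk A n u v) : HasWalk B n u v := by
  obtain ⟨f, h0, hn, hf⟩ := h
  exact ⟨f, h0, hn, fun i hi => hAB _ _ (hf i hi)⟩

theorem trans (h₁ : HasWalk A m u v) (h₂ : HasWalk A n v w) : HasWalk A (m + n) u w := by
  obtain ⟨f, f0, fm, hf⟩ := h₁
  obtain ⟨g, g0, gn, hg⟩ := h₂
  refine ⟨fun i => if i < m then f i else g (i - m), ?_, by simp [gn], ?_⟩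
  · rcases Nat.eq_zero_or_pos m with rfl | hm
    · simp only [lt_irrefl, if_false, Nat.sub_self]
      rw [g0, ← fm, f0]
    · simp [hm, f0]
  · intro i hi
    rcases lt_trichotomy (i + 1) m with h | h | h
    · simpa [h, show i < m by omega] using hf i (by omega)
    · have := hf i (by omega)
      rw [h, fm] at this
      simpa [h, show i < m by omega, g0] using this
    · have := hg (i - m) (by omega)
      rw [show i - m + 1 = i + 1 - m by omega] at this
      simpa [show ¬ i + 1 < m by omega, show ¬ i < m by omega] using this

theorem of_le {f : ℕ → V} {i j : ℕ} (hij : i ≤ j) (hf : ∀ k < j, A (f k) (f (k + 1))) :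
    HasWalk A (j - i) (f i) (f j) :=
  ⟨fun k => f (i + k), rfl, by simp [Nat.add_sub_cancel' hij], fun k hk => hf _ (by omega)⟩

theorem exists_step (h : HasWalk A n u v) (hne : u ≠ v) :
    ∃ w, A u w ∧ HasWalk A (n - 1) w v := by
  obtain ⟨f, rfl, rfl, hf⟩ := h
  have hn : 0 < n := Nat.pos_of_ne_zero (by rintro rfl; exact hne rfl)
  exact ⟨f 1, hf 0 hn, of_le hn hf⟩

/-- A shortest odd closed walk is a cycle. -/
theorem exists_odd_cycle (hn : Odd n) (h : HasWalk A n u u) :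
    ∃ m, Odd m ∧ ∃ c : ZMod m → V, Function.Injective c ∧ ∀ i, A (c i) (c (i + 1)) := by
  induction n using Nat.strong_induction_on generalizing u with
  | _ n ih =>
    obtain ⟨f, f0, fn, hf⟩ := h
    by_cases hrep : ∃ i j, i < j ∧ j < n ∧ f i = f j
    · obtain ⟨i, j, hij, hjn, hfij⟩ := hrep
      rcases Nat.even_or_odd (j - i) with hd | hd
      · have h₁ : HasWalk A (i - 0) (f 0) (f i) :=
          of_le (Nat.zero_le i) fun k hk => hf k (by omega)
        have h₂ : HasWalk A (n - j) (f j) (f n) := of_le hjn.le hf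
        rw [← hfij, fn] at h₂
        rw [f0] at h₁
        refine ih _ ?_ ?_ (h₁.trans h₂)
        · omega
        · rw [Nat.odd_iff] at hn ⊢
          rw [Nat.even_iff] at hd
          omega
      · have h₁ : HasWalk A (j - i) (f i) (f j) := of_le hij.le fun k hk => hf k (by omega)
        rw [← hfij] at h₁
        exact ih _ (by omega) hd h₁
    · obtain ⟨k, rfl⟩ : ∃ k, n = k + 1 := ⟨n - 1, by have := hn.pos; omega⟩
      refine ⟨k + 1, hn, fun z => f z.val, ?_, ?_⟩
      · intro x y hxy
        apply ZMod.val_injective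
        have hx := ZMod.val_lt x
        have hy := ZMod.val_lt y
        rcases lt_trichotomy x.val y.val with h | h | h
        · exact absurd ⟨_, _, h, hy, hxy⟩ hrep
        · exact h
        · exact absurd ⟨_, _, h, hx, hxy.symm⟩ hrep
      · intro z
        change A (f z.val) (f (z + 1).val)
        have hz := ZMod.val_lt z
        have hstep := hf z.val hz
        have hval : (z + 1).val = (z.val + 1) % (k + 1) := by
          rw [ZMod.val_add, ZMod.val_one_eq_one_mod, Nat.add_mod_mod]
        rcases Nat.lt_or_ge (z.val + 1) (k + 1) with h | h
        · rw [hval, Nat.mod_eq_of_lt h]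
          exact hstep
        · have hzk : z.val + 1 = k + 1 := by omega
          rw [hzk, fn, ← f0] at hstep
          rwa [hval, hzk, Nat.mod_self]

end HasWalk

/-- From some vertex of a nonempty finite set, every walk inside the set can be closed up. -/
theorem exists_forall_hasWalk_back {V : Type*} (A : V → V → Prop)
    {S : Finset V} (hS : S.Nonempty) (hA : ∀ u v, A u v → v ∈ S) :
    ∃ r ∈ S, ∀ n v, HasWalk A n r v → ∃ m, HasWalk A m v r := by
  classical
  let reach : V → Finset V := fun r => S.filter fun v => ∃ n, HasWalk A n r v
  obtain ⟨r, hrS, hmin⟩ := S.exists_min_image (fun r => (reach r).card) hS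
  refine ⟨r, hrS, fun n v hv => ?_⟩
  have hvS : v ∈ S := by
    obtain ⟨f, f0, fn, hf⟩ := hv
    rcases n with _ | n
    · rwa [← fn, f0]
    · exact fn ▸ hA _ _ (hf n (Nat.lt_succ_self n))
  have hsub : reach v ⊆ reach r := by
    intro x hx
    obtain ⟨hxS, m, hm⟩ := Finset.mem_filter.1 hx
    exact Finset.mem_filter.2 ⟨hxS, _, hv.trans hm⟩
  have heq := Finset.eq_of_subset_of_card_le hsub (hmin v hvS)
  have hr : r ∈ reach r := Finset.mem_filter.2 ⟨hrS, 0, HasWalk.refl A r⟩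
  rw [← heq] at hr
  exact (Finset.mem_filter.1 hr).2

/-- **Richardson's theorem**: a finite digraph without odd closed walks has a kernel. -/
theorem exists_kernel_of_no_odd_closed_walk {V : Type*} (A : V → V → Prop)
    (hA : ∀ n u, Odd n → ¬ HasWalk A n u u) (S : Finset V) :
    ∃ K ⊆ S, (∀ u ∈ K, ∀ v ∈ K, ¬ A u v) ∧ ∀ v ∈ S, v ∉ K → ∃ u ∈ K, A v u := by
  classical
  induction S using Finset.strongInduction with
  | _ S ih =>
    rcases S.eq_empty_or_nonempty with rfl | hS
    · exact ⟨∅, by simp⟩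
    let B : V → V → Prop := fun u v => u ∈ S ∧ v ∈ S ∧ A u v
    have hB : ∀ n u, Odd n → ¬ HasWalk B n u u := fun n u hn h =>
      hA n u hn (h.mono fun _ _ h => h.2.2)
    obtain ⟨r, hrS, hback⟩ := exists_forall_hasWalk_back B hS fun _ _ h => h.2.1
    let T : Finset V := S.filter fun v => ∃ n, Even n ∧ HasWalk B n r v
    have hrT : r ∈ T := Finset.mem_filter.2 ⟨hrS, 0, by simp, HasWalk.refl B r⟩
    have hparity : ∀ m n v, HasWalk B m r v → HasWalk B n v r → Even (m + n) := by
      intro m n v h₁ h₂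
      by_contra h
      exact hB _ _ (Nat.not_even_iff_odd.1 h) (h₁.trans h₂)
    have hTindep : ∀ u ∈ T, ∀ v ∈ T, ¬ A u v := by
      intro u hu v hv huv
      obtain ⟨huS, m, hm, hmw⟩ := Finset.mem_filter.1 hu
      obtain ⟨hvS, n, hn, hnw⟩ := Finset.mem_filter.1 hv
      obtain ⟨k, hk⟩ := hback n v hnw
      have h₁ := hparity _ _ _ hnw hk
      have h₂ := hparity _ _ _ (hmw.trans (HasWalk.single (A := B) ⟨huS, hvS, huv⟩)) hk
      rw [Nat.even_iff] at *
      omega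
    have hTout : ∀ u ∈ T, ∀ v ∈ S, A u v → ∃ w ∈ T, A v w := by
      intro u hu v hvS huv
      obtain ⟨huS, m, hm, hmw⟩ := Finset.mem_filter.1 hu
      have hv := hmw.trans (HasWalk.single (A := B) ⟨huS, hvS, huv⟩)
      obtain ⟨k, hk⟩ := hback _ v hv
      have hne : v ≠ r := by
        rintro rfl
        exact hTindep u hu v hrT huv
      obtain ⟨w, hvw, -⟩ := hk.exists_step hne
      refine ⟨w, Finset.mem_filter.2 ⟨hvw.2.1, _, ?_, hv.trans (HasWalk.single hvw)⟩, hvw.2.2⟩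
      rw [Nat.even_iff] at *
      omega
    let S' : Finset V := S.filter fun v => v ∉ T ∧ ∀ w ∈ T, ¬ A v w
    have hS' : S' ⊂ S := by
      exact Finset.filter_ssubset.2 ⟨r, hrS, fun h => h.1 hrT⟩
    obtain ⟨K, hKS, hKindep, hKabs⟩ := ih S' hS'
    refine ⟨T ∪ K, Finset.union_subset (Finset.filter_subset _ _) (hKS.trans hS'.subset), ?_, ?_⟩
    · intro u hu v hv huv
      rcases Finset.mem_union.1 hu with hu | hu <;> rcases Finset.mem_union.1 hv with hv | hv
      · exact hTindep u hu v hv huv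
      · obtain ⟨hvS, -, hvT⟩ := Finset.mem_filter.1 (hKS hv)
        obtain ⟨w, hw, hvw⟩ := hTout u hu v hvS huv
        exact hvT w hw hvw
      · exact (Finset.mem_filter.1 (hKS hu)).2.2 v hv huv
      · exact hKindep u hu v hv huv
    · intro v hvS hv
      rw [Finset.mem_union, not_or] at hv
      by_cases h : ∃ w ∈ T, A v w
      · obtain ⟨w, hw, hvw⟩ := h
        exact ⟨w, Finset.mem_union_left _ hw, hvw⟩
      · push Not at h
        obtain ⟨w, hw, hvw⟩ := hKabs v (Finset.mem_filter.2 ⟨hvS, hv.1, h⟩) hv.2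
        exact ⟨w, Finset.mem_union_right _ hw, hvw⟩

theorem derangement_assignment_oddCycles
    {V E α : Type*} [Fintype V] [Fintype E]
    (ends : E → Sym2 V)
    (hloopless : ∀ e, ¬ (ends e).IsDiag)
    (L : V → Finset α)
    (C : E → V → α → V → α → Prop)
    -- `(L, C)` is a correspondence assignment:
    (hCsymm : ∀ e u a v b, C e u a v b → C e v b u a)
    (hCsupp : ∀ e u a v b, C e u a v b → ends e = s(u, v) ∧ a ∈ L u ∧ b ∈ L v)
    (hCmatch : ∀ e u a v b b', C e u a v b → C e u a v b' → b = b')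
    -- `(L, C)` is a derangement assignment: every twisted edge is a partial derangement:
    (hder : ∀ e, ¬ (∀ u a v b, C e u a v b → a = b) →
      ∀ u v c, c ∈ L u → c ∈ L v → ¬ C e u c v c)
    -- `D` is a biorientation of `G`:
    (D : E → V → V → Prop)
    (hDsupp : ∀ e u v, D e u v → ends e = s(u, v))
    (hDorient : ∀ e u v, ends e = s(u, v) → D e u v ∨ D e v u)
    -- (i) every twisted edge is oriented in both directions in `D`:
    (htwist : ∀ e, ¬ (∀ u a v b, C e u a v b → a = b) →
      ∀ u v, ends e = s(u, v) → D e u v ∧ D e v u)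
    -- (ii) every odd directed cycle of `D` contains a twisted edge:
    (hodd : ∀ (n : ℕ), Odd n → ∀ (c : ZMod n → V) (ce : ZMod n → E),
      Function.Injective c → (∀ i, D (ce i) (c i) (c (i + 1))) →
      ∃ i, ¬ (∀ x a y b, C (ce i) x a y b → a = b))
    -- (iii) `|L v| ≥ d⁺_D v + 1` for every vertex `v`:
    (hsize : ∀ v, (L v).card ≥ Nat.card {e : E // ∃ w, D e v w} + 1) :
    -- Conclusion: `G` admits an `(L, C)`-coloring.
    ∃ φ : V → α, (∀ v, φ v ∈ L v) ∧
      ∀ e u v, ends e = s(u, v) → ¬ C e u (φ u) v (φ v) := by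
  classical
  -- Colour a kernel with one colour, delete it, and recurse on the remaining vertices.
  suffices key : ∀ (W : Finset V) (M : V → Finset α), (∀ v, M v ⊆ L v) →
      (∀ v ∈ W, (Finset.univ.filter fun e => ∃ w ∈ W, D e v w).card < (M v).card) →
      ∃ φ : V → α, (∀ v ∈ W, φ v ∈ M v) ∧
        ∀ e, ∀ u ∈ W, ∀ v ∈ W, ¬ C e u (φ u) v (φ v) by
    obtain ⟨φ, hφ, hφC⟩ := key Finset.univ L (fun v => subset_rfl) (by
      intro v _
      have := hsize v
      rw [Nat.card_eq_fintype_card, Fintype.card_subtype] at this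
      simpa using this)
    exact ⟨φ, fun v => hφ v (Finset.mem_univ v),
      fun e u v _ => hφC e u (Finset.mem_univ u) v (Finset.mem_univ v)⟩
  intro W
  induction W using Finset.strongInduction with
  | _ W ih =>
    intro M hML hcard
    rcases W.eq_empty_or_nonempty with rfl | ⟨v₀, hv₀⟩
    · exact ⟨fun v => (Finset.card_pos.1 (Nat.zero_lt_of_lt (hsize v))).choose, by simp, by simp⟩
    obtain ⟨c, hc⟩ := Finset.card_pos.1 (Nat.zero_lt_of_lt (hcard v₀ hv₀))
    let A : V → V → Prop := fun u v => ∃ e, D e u v ∧ C e u c v c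
    have hA : ∀ n u, Odd n → ¬ HasWalk A n u u := by
      intro n u hn h
      obtain ⟨m, hm, cyc, hinj, hcyc⟩ := h.exists_odd_cycle hn
      choose ce hce using hcyc
      obtain ⟨i, hi⟩ := hodd m hm cyc ce hinj fun i => (hce i).1
      have hs := hCsupp _ _ _ _ _ (hce i).2
      exact hder _ hi _ _ c hs.2.1 hs.2.2 (hce i).2
    obtain ⟨K, hKS, hKindep, hKabs⟩ :=
      exists_kernel_of_no_odd_closed_walk A hA (W.filter fun v => c ∈ M v)
    have hKW : K ⊆ W := hKS.trans (Finset.filter_subset _ _)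
    have hKne : K.Nonempty := by
      by_cases h : v₀ ∈ K
      · exact ⟨v₀, h⟩
      · obtain ⟨u, hu, -⟩ := hKabs v₀ (Finset.mem_filter.2 ⟨hv₀, hc⟩) h
        exact ⟨u, hu⟩
    let R : V → Finset α := fun v => (M v).filter fun b => ∃ e, ∃ u ∈ K, C e u c v b
    have hR : ∀ v ∈ W \ K, ∀ b : R v, ∃ e, ∃ u ∈ K, C e u c v b ∧ D e v u := by
      rintro v hv ⟨b, hb⟩
      obtain ⟨hvW, hvK⟩ := Finset.mem_sdiff.1 hv
      obtain ⟨hbM, e, u, hu, he⟩ := Finset.mem_filter.1 hb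
      by_cases hbc : b = c
      · subst hbc
        obtain ⟨w, hw, e', hD, hC⟩ := hKabs v (Finset.mem_filter.2 ⟨hvW, hbM⟩) hvK
        exact ⟨e', w, hw, hCsymm _ _ _ _ _ hC, hD⟩
      · exact ⟨e, u, hu, he,
          (htwist e (fun h => hbc (h _ _ _ _ he).symm) u v (hCsupp _ _ _ _ _ he).1).2⟩
    have hcard' : ∀ v ∈ W \ K,
        (Finset.univ.filter fun e => ∃ w ∈ W \ K, D e v w).card < (M v \ R v).card := by
      intro v hv
      choose g x hx hgC hgD using hR v hv
      have hends : ∀ b w, ends (g b) = s(v, w) → w = x b := by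
        intro b w hw
        rw [hDsupp _ _ _ (hgD b)] at hw
        exact (Sym2.congr_right.1 hw).symm
      have hginj : Function.Injective g := by
        intro a b hab
        have hxx : x a = x b :=
          hends b _ (by rw [← hab]; exact hDsupp _ _ _ (hgD a))
        have h₁ := hgC a
        rw [hab, hxx] at h₁
        exact Subtype.ext (hCmatch _ _ _ _ _ _ h₁ (hgC b))
      have hdisj : Disjoint (Finset.univ.filter fun e => ∃ w ∈ W \ K, D e v w)
          (Finset.univ.image g) := by
        rw [Finset.disjoint_left]
        intro e he heg
        obtain ⟨b, -, rfl⟩ := Finset.mem_image.1 heg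
        obtain ⟨-, w, hw, hD⟩ := Finset.mem_filter.1 he
        have := hends b w (hDsupp _ _ _ hD)
        exact (Finset.mem_sdiff.1 hw).2 (this ▸ hx b)
      have hsub : (Finset.univ.filter fun e => ∃ w ∈ W \ K, D e v w) ∪ Finset.univ.image g ⊆
          Finset.univ.filter fun e => ∃ w ∈ W, D e v w := by
        intro e he
        rcases Finset.mem_union.1 he with he | he
        · obtain ⟨-, w, hw, hD⟩ := Finset.mem_filter.1 he
          exact Finset.mem_filter.2 ⟨Finset.mem_univ _, w, (Finset.mem_sdiff.1 hw).1, hD⟩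
        · obtain ⟨b, -, rfl⟩ := Finset.mem_image.1 he
          exact Finset.mem_filter.2 ⟨Finset.mem_univ _, x b, hKW (hx b), hgD b⟩
      have h₁ := Finset.card_le_card hsub
      rw [Finset.card_union_of_disjoint hdisj, Finset.card_image_of_injective _ hginj,
        Finset.card_univ, Fintype.card_coe] at h₁
      have h₂ := hcard v (Finset.mem_sdiff.1 hv).1
      have h₃ : (M v \ R v).card + (R v).card = (M v).card :=
        Finset.card_sdiff_add_card_eq_card (Finset.filter_subset _ _)
      omega
    obtain ⟨φ, hφ, hφC⟩ := ih (W \ K) (Finset.sdiff_ssubset hKW hKne) (fun v => M v \ R v)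
      (fun v => Finset.sdiff_subset.trans (hML v)) hcard'
    have hcross : ∀ e, ∀ u ∈ K, ∀ v ∈ W \ K, ¬ C e u c v (φ v) := by
      intro e u hu v hv h
      obtain ⟨hM, hnR⟩ := Finset.mem_sdiff.1 (hφ v hv)
      exact hnR (Finset.mem_filter.2 ⟨hM, e, u, hu, h⟩)
    refine ⟨fun v => if v ∈ K then c else φ v, ?_, ?_⟩
    · intro v hv
      by_cases hvK : v ∈ K
      · simpa [hvK] using (Finset.mem_filter.1 (hKS hvK)).2
      · simpa [hvK] using (Finset.mem_sdiff.1 (hφ v (Finset.mem_sdiff.2 ⟨hv, hvK⟩))).1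
    · intro e u hu v hv h
      by_cases huK : u ∈ K <;> by_cases hvK : v ∈ K <;>
        simp only [huK, hvK, if_true, if_false] at h
      · rcases hDorient e u v (hCsupp _ _ _ _ _ h).1 with hD | hD
        · exact hKindep u huK v hvK ⟨e, hD, h⟩
        · exact hKindep v hvK u huK ⟨e, hD, hCsymm _ _ _ _ _ h⟩
      · exact hcross e u huK v (Finset.mem_sdiff.2 ⟨hv, hvK⟩) h
      · exact hcross e v hvK u (Finset.mem_sdiff.2 ⟨hu, huK⟩) (hCsymm _ _ _ _ _ h)
      · exact hφC e u (Finset.mem_sdiff.2 ⟨hu, huK⟩) v (Finset.mem_sdiff.2 ⟨hv, hvK⟩) h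
end

section
/- Let (G,σ) be a signed graph and let D be a biorientation of G such that every negative edge (edge e with σ(e) = −1) is oriented in both directions in D, and such that D induces a kernel-perfect biorientation of the positive subgraph G⁺. If L = {L(v)} is a list assignment with L(v) ⊆ ℤ \ {0} and |L(v)| ≥ d⁺_D(v) + 1 for every vertex v of G, then (G,σ) admits an (L,σ)-coloring. -/
open scoped Classical in
/-- Colouring of a set `S` of vertices, from lists exceeding the out-degrees inside `S`. -/
theorem exists_signed_coloring_on {V : Type*}
    (G : SimpleGraph V) (σ : Sym2 V → ℤ)
    (hσ : ∀ e ∈ G.edgeSet, σ e = 1 ∨ σ e = -1)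
    (D : V → V → Prop)
    (hneg : ∀ u v, G.Adj u v → σ s(u, v) = -1 → D u v)
    (hkernel : ∀ A : Set V, ∃ U ⊆ A,
      (∀ u ∈ U, ∀ u' ∈ U, ¬ (G.Adj u u' ∧ σ s(u, u') = 1)) ∧
      (∀ v ∈ A, v ∉ U → ∃ u ∈ U, D v u ∧ σ s(v, u) = 1))
    (S : Finset V) (L : V → Finset ℤ)
    (hL0 : ∀ v, (0 : ℤ) ∉ L v)
    (hsize : ∀ v ∈ S, (S.filter (D v)).card + 1 ≤ (L v).card) :
    ∃ ψ : V → ℤ, (∀ v ∈ S, ψ v ∈ L v) ∧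
      ∀ u ∈ S, ∀ v ∈ S, G.Adj u v → ψ u ≠ σ s(u, v) * ψ v := by
  induction S using Finset.strongInduction generalizing L with
  | H S ih =>
  rcases S.eq_empty_or_nonempty with rfl | ⟨v₀, hv₀⟩
  · exact ⟨0, by simp, by simp⟩
  obtain ⟨c, hc⟩ : (L v₀).Nonempty :=
    Finset.card_pos.mp ((Nat.succ_pos _).trans_le (hsize v₀ hv₀))
  have hc0 : c ≠ 0 := fun h => hL0 v₀ (h ▸ hc)
  obtain ⟨U, hUA, hind, habs⟩ := hkernel {v | v ∈ S ∧ c ∈ L v}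
  have hU : U.Nonempty := by
    by_contra h
    rw [Set.not_nonempty_iff_eq_empty] at h
    obtain ⟨u, hu, -⟩ := habs v₀ ⟨hv₀, hc⟩ (by simp [h])
    simp [h] at hu
  have hssub : S.filter (· ∉ U) ⊂ S := by
    obtain ⟨u, hu⟩ := hU
    exact Finset.filter_ssubset.mpr ⟨u, (hUA hu).1, by simpa using hu⟩
  let L' : V → Finset ℤ := fun v =>
    (L v).filter fun x => ∀ u ∈ U, G.Adj v u → x ≠ σ s(v, u) * c
  obtain ⟨ψ, hψL, hψ⟩ := ih _ hssub L' (fun v h => hL0 v (Finset.mem_filter.mp h).1) (by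
    intro v hv
    obtain ⟨hvS, hvU⟩ := Finset.mem_filter.mp hv
    have hlost : ((L v).filter fun x => ¬ ∀ u ∈ U, G.Adj v u → x ≠ σ s(v, u) * c).card ≤
        ((S.filter (D v)).filter fun w => ¬ w ∉ U).card := by
      have hsub : ((L v).filter fun x => ¬ ∀ u ∈ U, G.Adj v u → x ≠ σ s(v, u) * c) ⊆
          ((S.filter (D v)).filter fun w => ¬ w ∉ U).image fun u => σ s(v, u) * c := by
        intro x hx
        simp only [Finset.mem_filter, not_forall, not_not] at hx
        obtain ⟨hxL, u, hu, hadj, rfl⟩ := hx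
        simp only [Finset.mem_image, Finset.mem_filter, not_not]
        rcases hσ _ (G.mem_edgeSet.mpr hadj) with h | h
        · rw [h, one_mul] at hxL
          obtain ⟨w, hw, hDw, hσw⟩ := habs v ⟨hvS, hxL⟩ hvU
          exact ⟨w, ⟨⟨(hUA hw).1, hDw⟩, hw⟩, by rw [h, hσw]⟩
        · exact ⟨u, ⟨⟨(hUA hu).1, hneg _ _ hadj h⟩, hu⟩, rfl⟩
      exact (Finset.card_le_card hsub).trans Finset.card_image_le
    have hL := Finset.card_filter_add_card_filter_not (s := L v)
      (fun x => ∀ u ∈ U, G.Adj v u → x ≠ σ s(v, u) * c)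
    have hD := Finset.card_filter_add_card_filter_not (s := S.filter (D v)) (fun w => w ∉ U)
    have := hsize v hvS
    rw [Finset.filter_comm]
    simp only [L']
    omega)
  have hcross : ∀ u ∈ U, ∀ v ∈ S, v ∉ U → G.Adj v u → ψ v ≠ σ s(v, u) * c :=
    fun u hu v hv hvU =>
      (Finset.mem_filter.mp (hψL v (Finset.mem_filter.mpr ⟨hv, hvU⟩))).2 u hu
  refine ⟨fun v => if v ∈ U then c else ψ v, fun v hv => ?_, fun u hu v hv hadj => ?_⟩
  · by_cases hvU : v ∈ U
    · simpa [hvU] using (hUA hvU).2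
    · simpa [hvU] using (Finset.mem_filter.mp (hψL v (Finset.mem_filter.mpr ⟨hv, hvU⟩))).1
  · by_cases huU : u ∈ U <;> by_cases hvU : v ∈ U <;> simp only [huU, hvU, if_true, if_false]
    · rcases hσ _ (G.mem_edgeSet.mpr hadj) with h | h
      · exact absurd ⟨hadj, h⟩ (hind u huU v hvU)
      · rw [h]; omega
    · have := hcross u huU v hv hvU hadj.symm
      rw [Sym2.eq_swap] at this
      rcases hσ _ (G.mem_edgeSet.mpr hadj) with h | h <;> rw [h] at this ⊢ <;> omega
    · exact hcross v hvU u hu huU hadj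
    · exact hψ u (Finset.mem_filter.mpr ⟨hu, huU⟩) v (Finset.mem_filter.mpr ⟨hv, hvU⟩) hadj


/-!
Statement 2 (Corollary, BBS for zero-free signed list colorings):
`(G, σ)` is a signed graph: `G` is a finite loopless (simple) graph and
`σ` assigns `1` or `-1` to every edge (encoded as `σ : Sym2 V → ℤ` taking values
in `{-1, 1}` on the edge set).

`D : V → V → Prop` is a biorientation of `G` (`D u v` is the arc `u → v`;
every edge is oriented in at least one direction, and arcs only join adjacent
vertices) such that every negative edge is oriented in both directions and `D`
induces a kernel-perfect biorientation of the positive subgraph `G⁺`: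
for every `A : Set V` there is a kernel `U ⊆ A` (independent in `G⁺`, and every
vertex of `A \ U` sends a positive arc into `U`).

If `L v ⊆ ℤ \ {0}` and `|L v| ≥ d⁺_D v + 1` for every vertex `v` (with
`d⁺_D v = Nat.card {w // D v w}`), then `(G, σ)` admits an `(L, σ)`-coloring.
-/
theorem signed_BBS {V : Type*} [Fintype V]
    (G : SimpleGraph V)
    (σ : Sym2 V → ℤ)
    (hσ : ∀ e ∈ G.edgeSet, σ e = 1 ∨ σ e = -1)
    -- `D` is a biorientation of `G`:
    (D : V → V → Prop)
    (hD1 : ∀ u v, D u v → G.Adj u v)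
    (hD2 : ∀ u v, G.Adj u v → D u v ∨ D v u)
    -- every negative edge is oriented in both directions in `D`:
    (hneg : ∀ u v, G.Adj u v → σ s(u, v) = -1 → D u v ∧ D v u)
    -- `D` induces a kernel-perfect biorientation of the positive subgraph `G⁺`:
    (hkernel : ∀ A : Set V, ∃ U ⊆ A,
      (∀ u ∈ U, ∀ u' ∈ U, ¬ (G.Adj u u' ∧ σ s(u, u') = 1)) ∧
      (∀ v ∈ A, v ∉ U → ∃ u ∈ U, D v u ∧ σ s(v, u) = 1))
    -- the list assignment:
    (L : V → Finset ℤ)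
    (hL0 : ∀ v, (0 : ℤ) ∉ L v)
    (hsize : ∀ v, (L v).card ≥ Nat.card {w : V // D v w} + 1) :
    -- Conclusion: `(G, σ)` admits an `(L, σ)`-coloring.
    ∃ ψ : V → ℤ, (∀ v, ψ v ∈ L v) ∧
      ∀ u v, G.Adj u v → ψ u ≠ σ s(u, v) * ψ v := by
  classical
  obtain ⟨ψ, hψL, hψ⟩ := exists_signed_coloring_on G σ hσ D
    (fun u v hadj h => (hneg u v hadj h).1) hkernel Finset.univ L hL0 (fun v _ => by
      simpa [Nat.card_eq_fintype_card, Fintype.card_subtype] using hsize v)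
  exact ⟨ψ, fun v => hψL v (Finset.mem_univ v),
    fun u v => hψ u (Finset.mem_univ u) v (Finset.mem_univ v)⟩
end

section
/- Let (G,σ) be a signed graph and let D be a biorientation of G such that every negative edge (edge e with σ(e) = −1) is oriented in both directions in D, and such that the orientation that D induces on the positive subgraph G⁺ has no odd directed cycles. If L = {L(v)} is a list assignment with L(v) ⊆ ℤ \ {0} and |L(v)| ≥ d⁺_D(v) + 1 for every vertex v of G, then (G,σ) admits an (L,σ)-coloring. -/
/-!
Statement 3 (Corollary, Richardson-type result for zero-free signed list
colorings): `(G, σ)` is a signed graph: `G` is a finite loopless (simple) graph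
and `σ` assigns `1` or `-1` to every edge (encoded as `σ : Sym2 V → ℤ` taking
values in `{-1, 1}` on the edge set).

`D : V → V → Prop` is a biorientation of `G` such that every negative edge is
oriented in both directions in `D` and the orientation induced by `D` on the
positive subgraph `G⁺` has no odd directed cycles.  A directed cycle of length
`n` in the induced orientation of `G⁺` is encoded as an injective map
`c : ZMod n → V` with a positive arc from `c i` to `c (i + 1)` for every `i`.

If `L v ⊆ ℤ \ {0}` and `|L v| ≥ d⁺_D v + 1` for every vertex `v` (with
`d⁺_D v = Nat.card {w // D v w}`), then `(G, σ)` admits an `(L, σ)`-coloring.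
-/
/-- There is a directed walk of length `n` from `u` to `v` along the relation `R`. -/
def DirectedWalk {V : Type*} (R : V → V → Prop) (n : ℕ) (u v : V) : Prop :=
  ∃ f : ℕ → V, f 0 = u ∧ f n = v ∧ ∀ i < n, R (f i) (f (i + 1))

namespace DirectedWalk

variable {V : Type*} {R : V → V → Prop}

theorem refl (u : V) : DirectedWalk R 0 u u := ⟨fun _ => u, rfl, rfl, by simp⟩

theorem single {u v : V} (h : R u v) : DirectedWalk R 1 u v :=
  ⟨fun i => if i = 0 then u else v, by simp, by simp, by
    intro i hi
    obtain rfl : i = 0 := by omega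
    simpa using h⟩

theorem trans {m n : ℕ} {u v w : V} (h₁ : DirectedWalk R m u v) (h₂ : DirectedWalk R n v w) :
    DirectedWalk R (m + n) u w := by
  obtain ⟨f, hf0, hfm, hf⟩ := h₁
  obtain ⟨g, hg0, hgn, hg⟩ := h₂
  refine ⟨fun i => if i < m then f i else g (i - m), ?_, ?_, ?_⟩
  · by_cases hm : 0 < m
    · simpa [hm] using hf0
    · obtain rfl : m = 0 := by omega
      simp [hg0, ← hfm, hf0]
  · simpa using hgn
  · intro i hi
    rcases lt_trichotomy (i + 1) m with h | h | h
    · simpa [h, show i < m by omega] using hf i (by omega)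
    · have := hf i (by omega)
      rw [h, hfm, ← hg0] at this
      simpa [h, show i < m by omega] using this
    · have := hg (i - m) (by omega)
      simpa [show ¬ i + 1 < m by omega, show ¬ i < m by omega,
        show i + 1 - m = i - m + 1 by omega] using this

theorem mono {R' : V → V → Prop} (hR : ∀ u v, R u v → R' u v) {n : ℕ} {u v : V}
    (h : DirectedWalk R n u v) : DirectedWalk R' n u v := by
  obtain ⟨f, h0, hn, hf⟩ := h
  exact ⟨f, h0, hn, fun i hi => hR _ _ (hf i hi)⟩

theorem segment {f : ℕ → V} {n i j : ℕ} (hf : ∀ k < n, R (f k) (f (k + 1))) (hij : i ≤ j)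
    (hj : j ≤ n) : DirectedWalk R (j - i) (f i) (f j) :=
  ⟨fun k => f (i + k), by simp, by simp [Nat.add_sub_cancel' hij],
    fun k hk => hf (i + k) (by omega)⟩

theorem exists_of_reflTransGen {u v : V} (h : Relation.ReflTransGen R u v) :
    ∃ n, DirectedWalk R n u v := by
  induction h with
  | refl => exact ⟨0, refl u⟩
  | tail _ hbc ih =>
    obtain ⟨n, hn⟩ := ih
    exact ⟨n + 1, hn.trans (single hbc)⟩

theorem reflTransGen {n : ℕ} {u v : V} (h : DirectedWalk R n u v) :
    Relation.ReflTransGen R u v := by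
  obtain ⟨f, rfl, rfl, hf⟩ := h
  induction n with
  | zero => rfl
  | succ n ih => exact (ih fun i hi => hf i (by omega)).tail (hf n (by omega))

end DirectedWalk

/-- A relation without odd directed cycles has no odd closed directed walks. -/
theorem not_directedWalk_of_no_odd_cycle {V : Type*} {R : V → V → Prop}
    (hodd : ∀ n : ℕ, Odd n → ∀ c : ZMod n → V, Function.Injective c →
      ¬ ∀ i, R (c i) (c (i + 1)))
    (n : ℕ) (hn : Odd n) (x : V) : ¬ DirectedWalk R n x x := by
  induction n using Nat.strong_induction_on generalizing x with
  | _ n ih =>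
  rintro ⟨f, h0, hfn, hf⟩
  have hpos : 0 < n := hn.pos
  have hinj : ∀ i j, i < j → j < n → f i ≠ f j := by
    intro i j hij hj heq
    have hmid := DirectedWalk.segment hf hij.le hj.le
    have hfst := DirectedWalk.segment hf (Nat.zero_le i) (hij.trans hj).le
    have hlst := DirectedWalk.segment hf hj.le le_rfl
    rw [heq] at hmid hfst
    rw [h0] at hfst
    rw [hfn] at hlst
    rcases Nat.even_or_odd (j - i) with he | ho
    · refine ih (i - 0 + (n - j)) (by omega) ?_ x (hfst.trans hlst)
      grind
    · exact ih (j - i) (by omega) ho _ hmid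
  have : NeZero n := ⟨hpos.ne'⟩
  refine hodd n hn (fun z => f z.val) ?_ ?_
  · intro a b hab
    apply ZMod.val_injective n
    rcases lt_trichotomy a.val b.val with h | h | h
    · exact absurd hab (hinj _ _ h b.val_lt)
    · exact h
    · exact absurd hab.symm (hinj _ _ h a.val_lt)
  · intro z
    have hz := z.val_lt
    have hval : (z + 1).val = (z.val + 1) % n := by
      rw [ZMod.val_add, ZMod.val_one_eq_one_mod, Nat.add_mod_mod]
    have hstep := hf z.val hz
    rw [hval]
    rcases Nat.lt_or_ge (z.val + 1) n with h | h
    · rwa [Nat.mod_eq_of_lt h]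
    · have h' : z.val + 1 = n := by omega
      rw [h', hfn, ← h0] at hstep
      rwa [h', Nat.mod_self]

/-- **Richardson's theorem**: if a relation has no odd closed directed walks, then every finite
set of vertices contains a kernel. -/
theorem exists_kernel {V : Type*} {R : V → V → Prop}
    (hodd : ∀ n : ℕ, Odd n → ∀ x, ¬ DirectedWalk R n x x) (S : Finset V) :
    ∃ K ⊆ S, (∀ u ∈ K, ∀ v ∈ K, ¬ R u v) ∧ ∀ u ∈ S, u ∉ K → ∃ v ∈ K, R u v := by
  classical
  induction S using Finset.strongInduction with
  | H S ih =>
  rcases S.eq_empty_or_nonempty with rfl | hS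
  · exact ⟨∅, by simp⟩
  let R' : V → V → Prop := fun u v => R u v ∧ u ∈ S ∧ v ∈ S
  have hR' : ∀ u v, R' u v → R u v := fun _ _ h => h.1
  let reach : V → Finset V := fun u => S.filter (Relation.ReflTransGen R' u)
  obtain ⟨x, hxS, hmin⟩ := S.exists_min_image (fun u => (reach u).card) hS
  have hback : ∀ y ∈ S, Relation.ReflTransGen R' x y → Relation.ReflTransGen R' y x := by
    intro y hy hxy
    have hsub : reach y ⊆ reach x := fun z hz => by
      simp only [reach, Finset.mem_filter] at hz ⊢
      exact ⟨hz.1, hxy.trans hz.2⟩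
    have hx : x ∈ reach x := by simp [reach, hxS, Relation.ReflTransGen.refl]
    rw [← Finset.eq_of_subset_of_card_le hsub (hmin y hy)] at hx
    exact (Finset.mem_filter.1 hx).2
  let K₀ := S.filter fun v => ∃ n, Even n ∧ DirectedWalk R' n x v
  let T := S.filter fun v => ¬ Relation.ReflTransGen R' x v ∧ ∀ k ∈ K₀, ¬ R v k
  have hTS : T ⊂ S := by
    refine Finset.ssubset_iff_subset_ne.2 ⟨Finset.filter_subset _ _, fun h => ?_⟩
    rw [← h] at hxS
    exact (Finset.mem_filter.1 hxS).2.1 .refl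
  obtain ⟨K₁, hK₁T, hind, habs⟩ := ih T hTS
  have hK₁ : ∀ v ∈ K₁, v ∈ S ∧ ¬ Relation.ReflTransGen R' x v ∧ ∀ k ∈ K₀, ¬ R v k :=
    fun v hv => Finset.mem_filter.1 (hK₁T hv)
  have hK₀ : ∀ v ∈ K₀, v ∈ S ∧ ∃ n, Even n ∧ DirectedWalk R' n x v :=
    fun v hv => Finset.mem_filter.1 hv
  refine ⟨K₀ ∪ K₁, Finset.union_subset (Finset.filter_subset _ _) (hK₁T.trans hTS.1), ?_, ?_⟩
  · intro u hu v hv huv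
    rcases Finset.mem_union.1 hu with hu | hu <;> rcases Finset.mem_union.1 hv with hv | hv
    · obtain ⟨huS, m, hm, hwu⟩ := hK₀ u hu
      obtain ⟨hvS, n, hn, hwv⟩ := hK₀ v hv
      obtain ⟨k, hk⟩ := DirectedWalk.exists_of_reflTransGen (hback v hvS hwv.reflTransGen)
      rcases Nat.even_or_odd k with he | ho
      · exact hodd _ ((hm.add_one).add_even he) x
          (((hwu.trans (.single ⟨huv, huS, hvS⟩)).trans hk).mono hR')
      · exact hodd _ (hn.add_odd ho) x ((hwv.trans hk).mono hR')
    · obtain ⟨huS, m, hm, hwu⟩ := hK₀ u hu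
      exact (hK₁ v hv).2.1 (hwu.reflTransGen.tail ⟨huv, huS, (hK₁ v hv).1⟩)
    · exact (hK₁ u hu).2.2 v hv huv
    · exact hind u hu v hv huv
  · intro u huS hu
    rw [Finset.mem_union, not_or] at hu
    by_cases hxu : Relation.ReflTransGen R' x u
    · obtain ⟨n, hn⟩ := DirectedWalk.exists_of_reflTransGen hxu
      have hno : Odd n := by
        by_contra h
        exact hu.1 (Finset.mem_filter.2 ⟨huS, n, Nat.not_odd_iff_even.1 h, hn⟩)
      rcases (hback u huS hxu).cases_head with rfl | ⟨w, huw, -⟩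
      · exact absurd (hn.mono hR') (hodd n hno _)
      · exact ⟨w, Finset.mem_union_left _ (Finset.mem_filter.2
          ⟨huw.2.2, n + 1, hno.add_one, hn.trans (.single huw)⟩), huw.1⟩
    · by_cases hk : ∃ k ∈ K₀, R u k
      · obtain ⟨k, hk, huk⟩ := hk
        exact ⟨k, Finset.mem_union_left _ hk, huk⟩
      · push Not at hk
        obtain ⟨v, hv, huv⟩ := habs u (Finset.mem_filter.2 ⟨huS, hxu, hk⟩) hu.2
        exact ⟨v, Finset.mem_union_right _ hv, huv⟩

open Classical in
/-- A signed graph can be coloured from zero-free lists larger than the out-degrees of a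
biorientation, if negative edges are bidirected and the positive arcs have kernels in every set
of vertices. -/
theorem exists_signed_coloring_of_kernels {V : Type*} {G : SimpleGraph V} {σ : Sym2 V → ℤ}
    (hσ : ∀ e ∈ G.edgeSet, σ e = 1 ∨ σ e = -1) {D : V → V → Prop}
    (hD : ∀ u v, G.Adj u v → D u v ∨ D v u)
    (hneg : ∀ u v, G.Adj u v → σ s(u, v) = -1 → D u v)
    (hker : ∀ S : Finset V, ∃ K ⊆ S, (∀ u ∈ K, ∀ v ∈ K, ¬ (D u v ∧ σ s(u, v) = 1)) ∧
      ∀ u ∈ S, u ∉ K → ∃ v ∈ K, D u v ∧ σ s(u, v) = 1)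
    (S : Finset V) (L : V → Finset ℤ) (hL0 : ∀ v, (0 : ℤ) ∉ L v)
    (hsize : ∀ v ∈ S, (S.filter (D v)).card + 1 ≤ (L v).card) :
    ∃ ψ : V → ℤ, (∀ v ∈ S, ψ v ∈ L v) ∧
      ∀ u ∈ S, ∀ v ∈ S, G.Adj u v → ψ u ≠ σ s(u, v) * ψ v := by
  induction S using Finset.strongInduction generalizing L with
  | H S ih =>
  rcases S.eq_empty_or_nonempty with rfl | ⟨v₀, hv₀⟩
  · exact ⟨0, by simp⟩
  obtain ⟨c, hc⟩ : (L v₀).Nonempty := by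
    have := hsize v₀ hv₀
    exact Finset.card_pos.1 (by omega)
  have hc0 : c ≠ 0 := fun h => hL0 v₀ (h ▸ hc)
  obtain ⟨K, hKS, hind, habs⟩ := hker (S.filter fun v => c ∈ L v)
  have hK : ∀ v ∈ K, v ∈ S ∧ c ∈ L v := fun v hv => Finset.mem_filter.1 (hKS hv)
  have hKne : K.Nonempty := by
    by_cases h : v₀ ∈ K
    · exact ⟨v₀, h⟩
    · obtain ⟨w, hw, -⟩ := habs v₀ (Finset.mem_filter.2 ⟨hv₀, hc⟩) h
      exact ⟨w, hw⟩
  let L' : V → Finset ℤ := fun v => (L v).filter fun d => ∀ w ∈ K, D v w → d ≠ σ s(v, w) * c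
  have hlt : S \ K ⊂ S := Finset.sdiff_ssubset (fun v hv => (hK v hv).1) hKne
  obtain ⟨ψ, hψL, hψ⟩ := ih (S \ K) hlt L' (fun v h => hL0 v (Finset.mem_filter.1 h).1) (by
    intro v hv
    have hsub : L v ⊆ L' v ∪ (K.filter (D v)).image fun w => σ s(v, w) * c := by
      intro d hd
      by_cases h : d ∈ L' v
      · exact Finset.mem_union_left _ h
      · simp only [L', Finset.mem_filter, hd, true_and] at h
        push Not at h
        obtain ⟨w, hw, hvw, rfl⟩ := h
        exact Finset.mem_union_right _
          (Finset.mem_image.2 ⟨w, Finset.mem_filter.2 ⟨hw, hvw⟩, rfl⟩)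
    have h₁ := (Finset.card_le_card hsub).trans (Finset.card_union_le _ _)
    have h₂ : _ ≤ (K.filter (D v)).card :=
      Finset.card_image_le (s := K.filter (D v)) (f := fun w => σ s(v, w) * c)
    have h₃ : ((S \ K).filter (D v)).card + (K.filter (D v)).card = (S.filter (D v)).card := by
      rw [← Finset.card_union_of_disjoint
        (Finset.disjoint_filter_filter Finset.sdiff_disjoint), ← Finset.filter_union,
        Finset.sdiff_union_of_subset fun v hv => (hK v hv).1]
    have h₄ := hsize v (Finset.mem_sdiff.1 hv).1
    omega)
  have hcross : ∀ v ∈ S, v ∉ K → ∀ u ∈ K, G.Adj v u → ψ v ≠ σ s(v, u) * c := by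
    intro v hv hvK u hu hadj
    obtain ⟨hvL, hav⟩ := Finset.mem_filter.1 (hψL v (Finset.mem_sdiff.2 ⟨hv, hvK⟩))
    rcases hσ s(v, u) hadj with h | h
    · intro heq
      rw [h, one_mul] at heq
      obtain ⟨w, hw, hvw, hpos⟩ := habs v (Finset.mem_filter.2 ⟨hv, heq ▸ hvL⟩) hvK
      exact hav w hw hvw (by rw [hpos, one_mul, heq])
    · exact hav u hu (hneg v u hadj h)
  refine ⟨fun v => if v ∈ K then c else ψ v, ?_, ?_⟩
  · intro v hv
    by_cases h : v ∈ K
    · simpa [h] using (hK v h).2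
    · simpa [h] using (Finset.mem_filter.1 (hψL v (Finset.mem_sdiff.2 ⟨hv, h⟩))).1
  · intro u hu v hv hadj
    by_cases hu' : u ∈ K <;> by_cases hv' : v ∈ K <;> simp only [hu', hv', if_true, if_false]
    · rcases hσ s(u, v) hadj with h | h
      · rcases hD u v hadj with h' | h'
        · exact absurd ⟨h', h⟩ (hind u hu' v hv')
        · exact absurd ⟨h', Sym2.eq_swap (a := u) ▸ h⟩ (hind v hv' u hu')
      · rw [h]
        omega
    · have := hcross v hv hv' u hu' hadj.symm
      rw [Sym2.eq_swap] at this
      rcases hσ s(u, v) hadj with h | h <;> rw [h] at this ⊢ <;> omega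
    · exact hcross u hu hu' v hv' hadj
    · exact hψ u (Finset.mem_sdiff.2 ⟨hu, hu'⟩) v (Finset.mem_sdiff.2 ⟨hv, hv'⟩) hadj

theorem signed_oddCycles {V : Type*} [Fintype V]
    (G : SimpleGraph V)
    (σ : Sym2 V → ℤ)
    (hσ : ∀ e ∈ G.edgeSet, σ e = 1 ∨ σ e = -1)
    -- `D` is a biorientation of `G`:
    (D : V → V → Prop)
    (hD1 : ∀ u v, D u v → G.Adj u v)
    (hD2 : ∀ u v, G.Adj u v → D u v ∨ D v u)
    -- every negative edge is oriented in both directions in `D`: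
    (hneg : ∀ u v, G.Adj u v → σ s(u, v) = -1 → D u v ∧ D v u)
    -- the orientation induced by `D` on `G⁺` has no odd directed cycles:
    (hodd : ∀ (n : ℕ), Odd n → ∀ c : ZMod n → V, Function.Injective c →
      ¬ (∀ i, D (c i) (c (i + 1)) ∧ σ s(c i, c (i + 1)) = 1))
    -- the list assignment:
    (L : V → Finset ℤ)
    (hL0 : ∀ v, (0 : ℤ) ∉ L v)
    (hsize : ∀ v, (L v).card ≥ Nat.card {w : V // D v w} + 1) :
    -- Conclusion: `(G, σ)` admits an `(L, σ)`-coloring.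
    ∃ ψ : V → ℤ, (∀ v, ψ v ∈ L v) ∧
      ∀ u v, G.Adj u v → ψ u ≠ σ s(u, v) * ψ v := by
  classical
  have hwalk := not_directedWalk_of_no_odd_cycle (R := fun u v => D u v ∧ σ s(u, v) = 1) hodd
  obtain ⟨ψ, hψL, hψ⟩ := exists_signed_coloring_of_kernels hσ hD2
    (fun u v h h' => (hneg u v h h').1) (exists_kernel hwalk) Finset.univ L hL0 (by
      intro v _
      have := hsize v
      rw [Nat.card_eq_fintype_card, Fintype.card_subtype] at this
      convert this)
  exact ⟨ψ, fun v => hψL v (Finset.mem_univ v), fun u v =>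
    hψ u (Finset.mem_univ u) v (Finset.mem_univ v)⟩
end

section
/- Let (L,C) be a derangement assignment on a finite loopless multigraph G = (V,E). Suppose f_S : V → ℕ is such that there exists a kernel-perfect biorientation D_S of the straight subgraph G_S with f_S(v) ≥ d⁺_{D_S}(v) + 1 for every vertex v. If |L(v)| ≥ f_S(v) + d_{G_T}(v) for every vertex v, where d_{G_T}(v) is the degree of v in the twisted subgraph G_T, then G admits an (L,C)-coloring. -/
open scoped Classical in
/-- Coloring a set `S` of vertices from lists that are larger than the number of arcs plus the
number of twisted edges staying inside `S`. Here `P` marks the straight edges, so the two kinds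
of edges do not depend on the lists, which shrink along the induction. -/
theorem exists_coloring_of_kernelPerfect {V E α : Type*} [Fintype E] [Nonempty α]
    (ends : E → Sym2 V) (C : E → V → α → V → α → Prop) (P : E → Prop) (DS : E → V → V → Prop)
    (hCsymm : ∀ e u a v b, C e u a v b → C e v b u a)
    (hCmatch : ∀ e u a v b b', C e u a v b → C e u a v b' → b = b')
    (hstraight : ∀ e, P e → ∀ u a v b, C e u a v b → a = b)
    (hder : ∀ e, ¬ P e → ∀ u v c, ¬ C e u c v c)
    (hDS : ∀ e u v, DS e u v → ends e = s(u, v))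
    (hkernel : ∀ A : Set V, ∃ U : Set V, U ⊆ A ∧
      (∀ u ∈ U, ∀ u' ∈ U, ∀ e, P e → ends e ≠ s(u, u')) ∧
      (∀ v ∈ A, v ∉ U → ∃ u ∈ U, ∃ e, DS e v u))
    (S : Finset V) (L : V → Finset α)
    (hL : ∀ v ∈ S, (Finset.univ.filter fun e => ∃ w ∈ S, DS e v w).card +
      (Finset.univ.filter fun e => ¬ P e ∧ ∃ w ∈ S, ends e = s(v, w)).card + 1 ≤ (L v).card) :
    ∃ φ : V → α, (∀ v ∈ S, φ v ∈ L v) ∧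
      ∀ e, ∀ u ∈ S, ∀ v ∈ S, ends e = s(u, v) → ¬ C e u (φ u) v (φ v) := by
  induction S using Finset.strongInduction generalizing L with
  | H S ih =>
  obtain rfl | ⟨v₀, hv₀⟩ := S.eq_empty_or_nonempty
  · exact ⟨fun _ => Classical.arbitrary α, by simp, by simp⟩
  obtain ⟨c, hc⟩ : (L v₀).Nonempty := Finset.card_pos.mp (by have := hL v₀ hv₀; omega)
  obtain ⟨U, hUA, hUind, hUdom⟩ := hkernel {v | v ∈ S ∧ c ∈ L v}
  have hUne : ∃ u, u ∈ U := by
    by_cases h : v₀ ∈ U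
    · exact ⟨v₀, h⟩
    · obtain ⟨u, hu, -⟩ := hUdom v₀ ⟨hv₀, hc⟩ h
      exact ⟨u, hu⟩
  have other_unique : ∀ {e : E} {v w w' : V}, ends e = s(v, w) → ends e = s(v, w') → w = w' :=
    fun h h' => Sym2.congr_right.mp (h.symm.trans h')
  let S' := S.filter (· ∉ U)
  have hmem' : ∀ {v}, v ∈ S' ↔ v ∈ S ∧ v ∉ U := Finset.mem_filter
  have hS' : S' ⊂ S := by
    obtain ⟨u, hu⟩ := hUne
    exact Finset.filter_ssubset.mpr ⟨u, (hUA hu).1, not_not.mpr hu⟩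
  -- the colors forbidden by twisted edges to the kernel
  let B : V → Finset α := fun v =>
    (L v).filter fun b => ∃ e, ¬ P e ∧ ∃ u ∈ U, ends e = s(v, u) ∧ C e u c v b
  have hB : ∀ v, (B v).card ≤
      (Finset.univ.filter fun e => ¬ P e ∧ ∃ u ∈ U, ends e = s(v, u)).card := by
    intro v
    refine Finset.card_le_card_of_forall_subsingleton
      (fun b e => ∃ u ∈ U, ends e = s(v, u) ∧ C e u c v b) ?_ ?_
    · intro b hb
      obtain ⟨-, e, he, u, hu, hends, hC⟩ := Finset.mem_filter.mp hb
      exact ⟨e, by simpa using ⟨he, u, hu, hends⟩, u, hu, hends, hC⟩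
    · rintro e - b ⟨-, u, -, hends, hC⟩ b' ⟨-, u', -, hends', hC'⟩
      obtain rfl := other_unique hends hends'
      exact hCmatch _ _ _ _ _ _ hC hC'
  have hT : ∀ v, (Finset.univ.filter fun e => ¬ P e ∧ ∃ w ∈ S', ends e = s(v, w)).card +
      (Finset.univ.filter fun e => ¬ P e ∧ ∃ u ∈ U, ends e = s(v, u)).card ≤
      (Finset.univ.filter fun e => ¬ P e ∧ ∃ w ∈ S, ends e = s(v, w)).card := by
    intro v
    rw [← Finset.card_union_of_disjoint]
    · refine Finset.card_le_card fun e he => ?_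
      simp only [Finset.mem_union, Finset.mem_filter, Finset.mem_univ, true_and] at he ⊢
      rcases he with ⟨he, w, hw, h⟩ | ⟨he, w, hw, h⟩
      · exact ⟨he, w, (hmem'.mp hw).1, h⟩
      · exact ⟨he, w, (hUA hw).1, h⟩
    · rw [Finset.disjoint_filter]
      rintro e - ⟨-, w, hw, h⟩ ⟨-, u, hu, h'⟩
      exact (hmem'.mp hw).2 (other_unique h h' ▸ hu)
  have hD : ∀ v ∈ S', (Finset.univ.filter fun e => ∃ w ∈ S', DS e v w).card +
      (L v ∩ {c}).card ≤ (Finset.univ.filter fun e => ∃ w ∈ S, DS e v w).card := by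
    intro v hv
    have hsub : (Finset.univ.filter fun e => ∃ w ∈ S', DS e v w) ⊆
        Finset.univ.filter fun e => ∃ w ∈ S, DS e v w :=
      Finset.monotone_filter_right _ fun e _ ⟨w, hw, h⟩ => ⟨w, (hmem'.mp hw).1, h⟩
    by_cases hcv : c ∈ L v
    · obtain ⟨u, hu, e, he⟩ := hUdom v ⟨(hmem'.mp hv).1, hcv⟩ (hmem'.mp hv).2
      rw [Finset.inter_singleton_of_mem hcv, Finset.card_singleton]
      refine Finset.card_lt_card (Finset.ssubset_iff_of_subset hsub |>.mpr ⟨e, ?_, ?_⟩)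
      · simpa using ⟨u, (hUA hu).1, he⟩
      · intro hmem
        obtain ⟨w, hw, hew⟩ := (Finset.mem_filter.mp hmem).2
        exact (hmem'.mp hw).2 (other_unique (hDS _ _ _ hew) (hDS _ _ _ he) ▸ hu)
    · rw [Finset.inter_singleton_of_notMem hcv, Finset.card_empty]
      exact Finset.card_le_card hsub
  obtain ⟨φ, hφL, hφC⟩ := ih S' hS' (fun v => L v \ (L v ∩ {c} ∪ B v)) fun v hv => by
    have h₁ := Finset.le_card_sdiff (L v ∩ {c} ∪ B v) (L v)
    have h₂ := Finset.card_union_le (L v ∩ {c}) (B v)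
    have h₃ := hL v (hmem'.mp hv).1
    have h₄ := hB v
    have h₅ := hT v
    have h₆ := hD v hv
    omega
  have hφ : ∀ v ∈ S', φ v ∈ L v ∧ φ v ≠ c ∧ φ v ∉ B v := by
    intro v hv
    have := hφL v hv
    simp only [Finset.mem_sdiff, Finset.mem_union, Finset.mem_inter,
      Finset.mem_singleton, not_or, not_and] at this
    exact ⟨this.1, this.2.1 this.1, this.2.2⟩
  have hcross : ∀ e, ∀ u ∈ U, ∀ v ∈ S', ends e = s(v, u) → ¬ C e u c v (φ v) := by
    intro e u hu v hv hends hC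
    obtain ⟨h₁, h₂, h₃⟩ := hφ v hv
    by_cases hP : P e
    · exact h₂ (hstraight e hP _ _ _ _ hC).symm
    · exact h₃ (Finset.mem_filter.mpr ⟨h₁, e, hP, u, hu, hends, hC⟩)
  refine ⟨fun v => if v ∈ U then c else φ v, fun v hv => ?_, fun e u hu v hv hends => ?_⟩
  · by_cases hvU : v ∈ U
    · simpa [hvU] using (hUA hvU).2
    · simpa [hvU] using (hφ v (hmem'.mpr ⟨hv, hvU⟩)).1
  · by_cases huU : u ∈ U <;> by_cases hvU : v ∈ U <;> simp only [huU, hvU, if_true, if_false]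
    · exact hder e (fun hP => hUind u huU v hvU e hP hends) u v c
    · exact hcross e u huU v (hmem'.mpr ⟨hv, hvU⟩) (hends.trans Sym2.eq_swap)
    · exact fun hC => hcross e v hvU u (hmem'.mpr ⟨hu, huU⟩) hends (hCsymm _ _ _ _ _ hC)
    · exact hφC e u (hmem'.mpr ⟨hu, huU⟩) v (hmem'.mpr ⟨hv, hvU⟩) hends

/-!
Statement 4 (Corollary):
A finite loopless multigraph `G` is modeled by a vertex type `V`, an edge-index
type `E`, and an endpoint map `ends : E → Sym2 V` with no edge diagonal.
`(L, C)` is a derangement assignment on `G`.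

`f_S : V → ℕ` is such that there is a kernel-perfect biorientation
`D_S : E → V → V → Prop` of the straight subgraph `G_S` (its arcs run only along
straight edges, every straight edge gets at least one direction) with
`f_S v ≥ d⁺_{D_S} v + 1` for every vertex `v`.

If `|L v| ≥ f_S v + d_{G_T} v` for every `v`, where
`d_{G_T} v = Nat.card {e // e is twisted and v ∈ ends e}` is the degree of `v`
in the twisted subgraph, then `G` admits an `(L, C)`-coloring.
-/
theorem derangement_assignment_choosability
    {V E α : Type*} [Fintype V] [Fintype E]
    (ends : E → Sym2 V)
    (hloopless : ∀ e, ¬ (ends e).IsDiag)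
    (L : V → Finset α)
    (C : E → V → α → V → α → Prop)
    -- `(L, C)` is a correspondence assignment:
    (hCsymm : ∀ e u a v b, C e u a v b → C e v b u a)
    (hCsupp : ∀ e u a v b, C e u a v b → ends e = s(u, v) ∧ a ∈ L u ∧ b ∈ L v)
    (hCmatch : ∀ e u a v b b', C e u a v b → C e u a v b' → b = b')
    -- `(L, C)` is a derangement assignment: every twisted edge is a partial derangement:
    (hder : ∀ e, ¬ (∀ u a v b, C e u a v b → a = b) →
      ∀ u v c, c ∈ L u → c ∈ L v → ¬ C e u c v c)
    (fS : V → ℕ)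
    -- `D_S` is a biorientation of the straight subgraph `G_S`:
    (DS : E → V → V → Prop)
    (hDSsupp : ∀ e u v, DS e u v → ends e = s(u, v) ∧ (∀ x a y b, C e x a y b → a = b))
    (hDSorient : ∀ e u v, ends e = s(u, v) → (∀ x a y b, C e x a y b → a = b) →
      DS e u v ∨ DS e v u)
    -- `D_S` is kernel-perfect:
    (hkernel : ∀ A : Set V, ∃ U : Set V, U ⊆ A ∧
      (∀ u ∈ U, ∀ u' ∈ U, ∀ e, (∀ x a y b, C e x a y b → a = b) → ends e ≠ s(u, u')) ∧
      (∀ v ∈ A, v ∉ U → ∃ u ∈ U, ∃ e, DS e v u))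
    -- `f_S v ≥ d⁺_{D_S} v + 1` for every vertex `v`:
    (hfS : ∀ v, fS v ≥ Nat.card {e : E // ∃ w, DS e v w} + 1)
    -- `|L v| ≥ f_S v + d_{G_T} v` for every vertex `v`:
    (hsize : ∀ v, (L v).card ≥
      fS v + Nat.card {e : E // ¬ (∀ x a y b, C e x a y b → a = b) ∧ v ∈ ends e}) :
    -- Conclusion: `G` admits an `(L, C)`-coloring.
    ∃ φ : V → α, (∀ v, φ v ∈ L v) ∧
      ∀ e u v, ends e = s(u, v) → ¬ C e u (φ u) v (φ v) := by
  classical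
  rcases isEmpty_or_nonempty V with hV | ⟨⟨v₀⟩⟩
  · exact ⟨hV.elim, hV.elim, fun _ => hV.elim⟩
  obtain ⟨a₀, -⟩ : (L v₀).Nonempty :=
    Finset.card_pos.mp (by have := hsize v₀; have := hfS v₀; omega)
  have : Nonempty α := ⟨a₀⟩
  obtain ⟨φ, hφL, hφC⟩ := exists_coloring_of_kernelPerfect ends C
    (fun e => ∀ x a y b, C e x a y b → a = b) DS hCsymm hCmatch (fun _ he => he)
    (fun e he u v c hC => hder e he u v c (hCsupp _ _ _ _ _ hC).2.1 (hCsupp _ _ _ _ _ hC).2.2 hC)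
    (fun e u v h => (hDSsupp e u v h).1) hkernel Finset.univ L fun v _ => by
      have hcard : ∀ {p q : E → Prop} {_ : DecidablePred p}, (∀ e, p e → q e) →
          (Finset.univ.filter p).card ≤ Nat.card {e // q e} := fun hpq => by
        rw [Nat.card_eq_fintype_card, Fintype.card_subtype]
        exact Finset.card_le_card (Finset.monotone_filter_right _ fun e _ => hpq e)
      refine (Nat.add_le_add_right (Nat.add_le_add
        (hcard (q := fun e => ∃ w, DS e v w) ?_)
        (hcard (q := fun e => ¬ (∀ x a y b, C e x a y b → a = b) ∧ v ∈ ends e) ?_)) 1).trans ?_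
      · exact fun e ⟨w, _, h⟩ => ⟨w, h⟩
      · exact fun e ⟨he, w, _, h⟩ => ⟨he, h ▸ Sym2.mem_mk_left v w⟩
      have h₁ := hsize v
      have h₂ := hfS v
      omega
  exact ⟨φ, fun v => hφL v (Finset.mem_univ v),
    fun e u v => hφC e u (Finset.mem_univ u) v (Finset.mem_univ v)⟩
end

section
/- (Bondy–Boppana–Siegel lemma.) Let G = (V,E) be a finite loopless graph, let D be a kernel-perfect biorientation of G, and define f : V → ℕ by f(v) = d⁺_D(v) + 1 for each vertex v. Then G is f-choosable: for every assignment of lists L = {L(v)} with |L(v)| ≥ f(v) for each v, there exists a proper L-coloring of G, i.e., a function φ with φ(v) ∈ L(v) for all v and φ(u) ≠ φ(v) for every edge {u,v} of G. -/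
open Classical in
/-- A kernel-perfect digraph is colorable on any finite set `S` of vertices from lists that are
larger than the out-degrees in `S`. -/
theorem exists_listColoring_of_kernelPerfect {V α : Type*} [Nonempty α] (D : V → V → Prop)
    (hkernel : ∀ A : Set V, ∃ U ⊆ A,
      (∀ u ∈ U, ∀ u' ∈ U, ¬ D u u') ∧ (∀ v ∈ A, v ∉ U → ∃ u ∈ U, D v u))
    (S : Finset V) (L : V → Finset α)
    (hL : ∀ v ∈ S, (S.filter (D v)).card < (L v).card) :
    ∃ φ : V → α, (∀ v ∈ S, φ v ∈ L v) ∧ ∀ u ∈ S, ∀ v ∈ S, D u v → φ u ≠ φ v := by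
  induction S using Finset.strongInduction generalizing L with
  | H S ih =>
    obtain rfl | ⟨v₀, hv₀⟩ := S.eq_empty_or_nonempty
    · exact ⟨fun _ => Classical.arbitrary α, by simp, by simp⟩
    obtain ⟨c, hc⟩ := Finset.card_pos.mp (Nat.zero_lt_of_lt (hL v₀ hv₀))
    obtain ⟨U, hUA, hind, hdom⟩ := hkernel {v | v ∈ S ∧ c ∈ L v}
    have hss : S.filter (· ∉ U) ⊂ S := by
      rw [Finset.filter_ssubset]
      by_cases h : v₀ ∈ U
      · exact ⟨v₀, hv₀, not_not.mpr h⟩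
      · obtain ⟨u, hu, -⟩ := hdom v₀ ⟨hv₀, hc⟩ h
        exact ⟨u, (hUA hu).1, not_not.mpr hu⟩
    obtain ⟨φ, hφL, hφD⟩ := ih _ hss (fun v => (L v).erase c) (by
      intro v hv
      obtain ⟨hvS, hvU⟩ := Finset.mem_filter.mp hv
      have hsub : (S.filter (· ∉ U)).filter (D v) ⊆ S.filter (D v) :=
        Finset.filter_subset_filter _ hss.1
      by_cases hcv : c ∈ L v
      · obtain ⟨u, hu, hvu⟩ := hdom v ⟨hvS, hcv⟩ hvU
        have hlt : ((S.filter (· ∉ U)).filter (D v)).card < (S.filter (D v)).card :=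
          Finset.card_lt_card <| hsub.ssubset_of_mem_notMem
            (Finset.mem_filter.mpr ⟨(hUA hu).1, hvu⟩) (by simp [hu])
        have := hL v hvS
        rw [Finset.card_erase_of_mem hcv]
        omega
      · rw [Finset.erase_eq_of_notMem hcv]
        exact (Finset.card_le_card hsub).trans_lt (hL v hvS))
    have hφ : ∀ v ∈ S, v ∉ U → φ v ≠ c ∧ φ v ∈ L v := fun v hv hvU =>
      Finset.mem_erase.mp (hφL v (Finset.mem_filter.mpr ⟨hv, hvU⟩))
    refine ⟨fun v => if v ∈ U then c else φ v, fun v hv => ?_, fun u hu v hv huv => ?_⟩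
    · by_cases hvU : v ∈ U
      · simpa [hvU] using (hUA hvU).2
      · simpa [hvU] using (hφ v hv hvU).2
    · by_cases huU : u ∈ U <;> by_cases hvU : v ∈ U
      · exact absurd huv (hind u huU v hvU)
      · simpa [huU, hvU] using (hφ v hv hvU).1.symm
      · simpa [huU, hvU] using (hφ u hu huU).1
      · simpa [huU, hvU] using hφD u (by simp [hu, huU]) v (by simp [hv, hvU]) huv

/-!
Statement 5 (Bondy–Boppana–Siegel lemma):
`G` is a finite loopless (simple) graph, `D : V → V → Prop` is a kernel-perfect
biorientation of `G` (`D u v` is the arc `u → v`; arcs only join adjacent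
vertices and every edge is oriented in at least one direction).
Kernel-perfectness: for every `A : Set V`, the induced subdigraph on `A` has a
kernel `U ⊆ A`, i.e. `U` is independent and every vertex of `A \ U` has an
out-arc into `U`.

With `f v = d⁺_D v + 1` (where `d⁺_D v = Nat.card {w // D v w}`), the graph `G`
is `f`-choosable: every list assignment `L` with `|L v| ≥ f v = d⁺_D v + 1`
admits a proper `L`-coloring.
-/
theorem bondy_boppana_siegel {V α : Type*} [Fintype V]
    (G : SimpleGraph V)
    -- `D` is a biorientation of `G`:
    (D : V → V → Prop)
    (hD1 : ∀ u v, D u v → G.Adj u v)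
    (hD2 : ∀ u v, G.Adj u v → D u v ∨ D v u)
    -- `D` is kernel-perfect:
    (hkernel : ∀ A : Set V, ∃ U ⊆ A,
      (∀ u ∈ U, ∀ u' ∈ U, ¬ D u u') ∧
      (∀ v ∈ A, v ∉ U → ∃ u ∈ U, D v u))
    -- the list assignment, with `|L v| ≥ f v = d⁺_D v + 1`:
    (L : V → Finset α)
    (hsize : ∀ v, (L v).card ≥ Nat.card {w : V // D v w} + 1) :
    -- Conclusion: `G` admits a proper `L`-coloring.
    ∃ φ : V → α, (∀ v, φ v ∈ L v) ∧
      ∀ u v, G.Adj u v → φ u ≠ φ v := by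
  classical
  obtain hV | ⟨⟨v₀⟩⟩ := isEmpty_or_nonempty V
  · exact ⟨isEmptyElim, isEmptyElim, isEmptyElim⟩
  obtain ⟨c, -⟩ := Finset.card_pos.mp (Nat.zero_lt_of_lt (hsize v₀))
  have : Nonempty α := ⟨c⟩
  obtain ⟨φ, hφL, hφD⟩ := exists_listColoring_of_kernelPerfect D hkernel Finset.univ L
    fun v _ => by
      have := hsize v
      rw [Nat.card_eq_fintype_card, Fintype.card_subtype] at this
      exact this
  refine ⟨φ, fun v => hφL v (Finset.mem_univ v), fun u v huv => ?_⟩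
  obtain h | h := hD2 u v huv
  · exact hφD u (Finset.mem_univ u) v (Finset.mem_univ v) h
  · exact (hφD v (Finset.mem_univ v) u (Finset.mem_univ u) h).symm
end

section
/- There exists a correspondence assignment (L,C) on the 4-cycle C₄ with |L(v)| = 2 for every vertex v such that C₄ is not (L,C)-colorable. Consequently, the Bondy–Boppana–Siegel lemma fails for DP-colorings: the cyclic orientation D of C₄ is kernel-perfect and satisfies |L(v)| = d⁺_D(v) + 1 = 2 for every vertex v, yet C₄ admits no (L,C)-coloring. (Concretely, take L(v) = {1,2} for all four vertices, let three of the four edges carry the identity matching {{(u,1),(v,1)}, {(u,2),(v,2)}}, and let the remaining edge carry the crossed matching {{(u,1),(v,2)}, {(u,2),(v,1)}}.) -/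
/-- The 4-cycle `C₄`, with vertex set `ZMod 4` and `v` adjacent to `v ± 1`. -/
def cycleFour : SimpleGraph (ZMod 4) := SimpleGraph.fromRel (fun u v => v = u + 1)

/-- Every induced subdigraph of the cyclic orientation of `C₄` has a kernel. -/
theorem exists_kernel_cyclic_orientation (A : Set (ZMod 4)) : ∃ U ⊆ A,
    (∀ u ∈ U, ∀ u' ∈ U, ¬ (u' = u + 1)) ∧ (∀ v ∈ A, v ∉ U → ∃ u ∈ U, u = v + 1) := by
  classical
  have key : ∀ A : Finset (Fin 4), ∃ U : Finset (Fin 4), U ⊆ A ∧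
      (∀ u ∈ U, ∀ u' ∈ U, ¬ (u' = u + 1)) ∧ (∀ v ∈ A, v ∉ U → ∃ u ∈ U, u = v + 1) := by
    decide
  obtain ⟨U, hU, hind, habs⟩ := key A.toFinset
  refine ⟨{u | u ∈ U}, fun u hu => Set.mem_toFinset.mp (hU hu), hind, fun v hv => ?_⟩
  exact habs v (Set.mem_toFinset.mpr hv)

/-!
Statement 6: There is a correspondence assignment `(L, C)` on `C₄` with
`|L v| = 2` for every vertex, such that `C₄` has no `(L, C)`-coloring.
Here `C u v a b` means that the pair `{(u, a), (v, b)}` lies in the partial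
matching assigned to the edge `{u, v}`; the first three conjuncts say that
`(L, C)` is a correspondence assignment (symmetry, support on edges and lists,
and the matching condition).

Consequently the Bondy–Boppana–Siegel lemma fails for DP-colorings: the cyclic
orientation `D` of `C₄` (with arcs `v → v + 1`) is kernel-perfect and satisfies
`d⁺_D v + 1 = 2 = |L v|` for every vertex `v`, yet `C₄` is not
`(L, C)`-colorable.
-/
theorem BBS_fails_for_DP :
    ∃ (L : ZMod 4 → Finset ℕ) (C : ZMod 4 → ZMod 4 → ℕ → ℕ → Prop),
      -- `(L, C)` is a correspondence assignment on `C₄`: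
      (∀ u v a b, C u v a b → C v u b a) ∧
      (∀ u v a b, C u v a b → cycleFour.Adj u v ∧ a ∈ L u ∧ b ∈ L v) ∧
      (∀ u v a b b', C u v a b → C u v a b' → b = b') ∧
      -- every list has exactly two colors:
      (∀ v, (L v).card = 2) ∧
      -- the cyclic orientation `D v w ↔ w = v + 1` is kernel-perfect:
      (∀ A : Set (ZMod 4), ∃ U ⊆ A,
        (∀ u ∈ U, ∀ u' ∈ U, ¬ (u' = u + 1)) ∧
        (∀ v ∈ A, v ∉ U → ∃ u ∈ U, u = v + 1)) ∧
      -- and `|L v| = d⁺_D v + 1` for every vertex: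
      (∀ v : ZMod 4, (L v).card = Nat.card {w : ZMod 4 // w = v + 1} + 1) ∧
      -- yet `C₄` admits no `(L, C)`-coloring:
      ¬ ∃ φ : ZMod 4 → ℕ, (∀ v, φ v ∈ L v) ∧
          ∀ u v, cycleFour.Adj u v → ¬ C u v (φ u) (φ v) := by
  refine ⟨fun _ => {1, 2}, fun u v a b => cycleFour.Adj u v ∧ a ∈ ({1, 2} : Finset ℕ) ∧
    b ∈ ({1, 2} : Finset ℕ) ∧ (a = b ↔ ¬ (u = 3 ∧ v = 0 ∨ u = 0 ∧ v = 3)), ?_, ?_, ?_,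
    fun _ => rfl, exists_kernel_cyclic_orientation, fun v => by simp, ?_⟩
  · rintro u v a b ⟨huv, ha, hb, hab⟩
    exact ⟨huv.symm, hb, ha, by rw [eq_comm, hab]; tauto⟩
  · rintro u v a b ⟨huv, ha, hb, -⟩
    exact ⟨huv, ha, hb⟩
  · rintro u v a b b' ⟨-, ha, hb, hab⟩ ⟨-, -, hb', hab'⟩
    simp only [Finset.mem_insert, Finset.mem_singleton] at ha hb hb'
    have := hab.trans hab'.symm
    omega
  · rintro ⟨φ, hφ, hC⟩
    have adj (v : ZMod 4) : cycleFour.Adj v (v + 1) := by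
      have hne : (1 : ZMod 4) ≠ 0 := by decide
      simp [cycleFour, SimpleGraph.fromRel_adj, hne]
    have edge (v : ZMod 4) :
        ¬ (φ v = φ (v + 1) ↔ ¬ (v = 3 ∧ v + 1 = 0 ∨ v = 0 ∧ v + 1 = 3)) :=
      fun h => hC v (v + 1) (adj v) ⟨adj v, hφ v, hφ (v + 1), h⟩
    have h01 : φ 0 ≠ φ 1 := fun h => edge 0 (iff_of_true h (by decide))
    have h12 : φ 1 ≠ φ 2 := fun h => edge 1 (iff_of_true h (by decide))
    have h23 : φ 2 ≠ φ 3 := fun h => edge 2 (iff_of_true h (by decide))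
    have h30 : φ 3 = φ 0 := by
      by_contra h
      exact edge 3 (iff_of_false h (by decide))
    have hmem (v : ZMod 4) : φ v = 1 ∨ φ v = 2 := by simpa using hφ v
    have h0 := hmem 0
    have h1 := hmem 1
    have h2 := hmem 2
    have h3 := hmem 3
    omega
end
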